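/- Let R be a UFD with field of fractions K. Let a₁, a₂, b₁ ∈ R be nonzero, let A₁, A₂ ∈ R[X] and B₁ ∈ R[Y] satisfy A₁(0) = A₂(0) = B₁(0) = 0, and assume gcd(B₁, b₁) = 1. If the element Y + A₁(X)/a₁ + A₂(X + B₁(Y + A₁(X)/a₁)/b₁)/a₂ of K[X,Y] has all of its coefficients in R, then there exists C ∈ R[X] such that A₂(X) = C(b₁X). -/

import Mathlib

noncomputable section

/-- The element `Y + A₁(X)/a₁ + A₂(X + B₁(Y + A₁(X)/a₁)/b₁)/a₂` of `K[X,Y]`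
(`K` the fraction field of `R`): the second coordinate of `G₂∘F₂∘G₁∘F₁` where
`Fᵢ = (X, Y + Aᵢ(X)/aᵢ)` and `Gᵢ = (X + Bᵢ(Y)/bᵢ, Y)`. -/
def secondCoord {R : Type*} [CommRing R] [IsDomain R] (a₁ a₂ b₁ : R)
    (A₁ A₂ B₁ : Polynomial R) : MvPolynomial (Fin 2) (FractionRing R) :=
  let f := algebraMap R (FractionRing R)
  let Xv : MvPolynomial (Fin 2) (FractionRing R) := MvPolynomial.X 0
  let Yv : MvPolynomial (Fin 2) (FractionRing R) := MvPolynomial.X 1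
  let inner := Yv + MvPolynomial.C (f a₁)⁻¹ * Polynomial.aeval Xv (A₁.map f)
  inner + MvPolynomial.C (f a₂)⁻¹ *
    Polynomial.aeval
      (Xv + MvPolynomial.C (f b₁)⁻¹ * Polynomial.aeval inner (B₁.map f)) (A₂.map f)

open Polynomial in
/-- If a prime `p` of `R` does not divide `B` and `B(0) = 0`, then `p ∣ P ∘ B` implies `p ∣ P`. -/
theorem C_dvd_of_C_dvd_comp_of_prime {R : Type*} [CommRing R] [IsDomain R] {p : R}
    (hp : Prime p) {P B : R[X]} (hB0 : B.eval 0 = 0) (hB : ¬ C p ∣ B)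
    (h : C p ∣ P.comp B) : C p ∣ P := by
  have : (Ideal.span {p}).IsPrime := (Ideal.span_singleton_prime hp.ne_zero).2 hp
  have key : ∀ Q : R[X], C p ∣ Q ↔ Q.map (Ideal.Quotient.mk (Ideal.span {p})) = 0 := by
    intro Q
    simp only [C_dvd_iff_dvd_coeff, Polynomial.ext_iff, coeff_map, coeff_zero,
      Ideal.Quotient.eq_zero_iff_dvd]
  rw [key] at hB h ⊢
  rw [map_comp, comp_eq_zero_iff] at h
  refine h.resolve_right fun ⟨_, hconst⟩ => hB ?_
  rw [hconst, coeff_map, coeff_zero_eq_eval_zero, hB0, map_zero, C_0]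

open Polynomial in
/-- If no prime factor of `d` divides `B` and `B(0) = 0`, then `d ∣ P ∘ B` implies `d ∣ P`. -/
theorem C_dvd_of_C_dvd_comp {R : Type*} [CommRing R] [IsDomain R] [UniqueFactorizationMonoid R]
    {d : R} (hd : d ≠ 0) {P B : R[X]} (hB0 : B.eval 0 = 0)
    (hB : ∀ p, Prime p → p ∣ d → ¬ C p ∣ B) (h : C d ∣ P.comp B) : C d ∣ P := by
  induction d using UniqueFactorizationMonoid.induction_on_prime generalizing P with
  | h₁ => exact absurd rfl hd
  | h₂ u hu => exact (hu.map C).dvd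
  | h₃ a p ha hp ih =>
    obtain ⟨Q, rfl⟩ := C_dvd_of_C_dvd_comp_of_prime hp hB0 (hB p hp (dvd_mul_right p a))
      ((map_dvd C (dvd_mul_right p a)).trans h)
    rw [mul_comp, C_comp, C_mul] at h
    rw [C_mul]
    exact mul_dvd_mul_left _ (ih ha (fun q hq hqa => hB q hq (hqa.mul_left p))
      ((mul_dvd_mul_iff_left (C_ne_zero.2 hp.ne_zero)).1 h))

open Polynomial in
/-- Setting `X = 0` in `secondCoord` and clearing denominators. -/
theorem C_pow_dvd_scaleRoots_comp {R : Type*} [CommRing R] [IsDomain R] {a₁ a₂ b₁ : R}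
    (ha₂ : a₂ ≠ 0) (hb₁ : b₁ ≠ 0) {A₁ A₂ B₁ : R[X]} (hA₁0 : A₁.eval 0 = 0)
    (hint : ∀ m : Fin 2 →₀ ℕ,
      (secondCoord a₁ a₂ b₁ A₁ A₂ B₁).coeff m ∈ Set.range (algebraMap R (FractionRing R))) :
    C (b₁ ^ A₂.natDegree) ∣ (A₂.scaleRoots b₁).comp B₁ := by
  set f := algebraMap R (FractionRing R) with hf
  have hfinj : Function.Injective f := IsFractionRing.injective R (FractionRing R)
  obtain ⟨Q, hQ⟩ : secondCoord a₁ a₂ b₁ A₁ A₂ B₁ ∈ (MvPolynomial.map f).range :=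
    MvPolynomial.mem_range_map_iff_coeffs_subset.2 (by
      intro x hx
      obtain ⟨m, -, rfl⟩ := MvPolynomial.mem_coeffs_iff.1 hx
      exact hint m)
  set φ : MvPolynomial (Fin 2) (FractionRing R) →ₐ[FractionRing R] (FractionRing R)[X] :=
    MvPolynomial.aeval ![0, X] with hφ
  have hA₁ : A₁.coeff 0 = 0 := by rw [coeff_zero_eq_eval_zero, hA₁0]
  have hC : ∀ c, φ (MvPolynomial.C c) = C c := fun c => φ.commutes c
  have h₁ : φ (secondCoord a₁ a₂ b₁ A₁ A₂ B₁) =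
      X + C (f a₂)⁻¹ * aeval (C (f b₁)⁻¹ * B₁.map f) (A₂.map f) := by
    have hX : φ (MvPolynomial.X 0) = 0 := by simp [hφ]
    have hY : φ (MvPolynomial.X 1) = X := by simp [hφ]
    have hA : aeval (0 : (FractionRing R)[X]) (A₁.map f) = 0 := by
      rw [← coeff_zero_eq_aeval_zero', coeff_map, hA₁, map_zero, map_zero]
    simp only [secondCoord, map_add, map_mul, ← aeval_algHom_apply, hX, hY, hC, ← hf, hA,
      mul_zero, add_zero, zero_add, aeval_X_left_apply]
  have h₂ : φ (MvPolynomial.map f Q) = (MvPolynomial.aeval ![(0 : R[X]), X] Q).map f := by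
    suffices (φ : _ →+* _).comp (MvPolynomial.map f) = (mapRingHom f).comp
        (MvPolynomial.aeval ![(0 : R[X]), X] : MvPolynomial (Fin 2) R →ₐ[R] R[X]).toRingHom from
      DFunLike.congr_fun this Q
    refine MvPolynomial.ringHom_ext (fun r => ?_) fun i => ?_
    · simp [hC]
    · fin_cases i <;> simp [hφ]
  set S := MvPolynomial.aeval ![(0 : R[X]), X] Q
  refine ⟨C a₂ * (S - X), map_injective f hfinj ?_⟩
  have hfa : f a₂ ≠ 0 := (map_ne_zero_iff f hfinj).2 ha₂
  have hfb : f b₁ ≠ 0 := (map_ne_zero_iff f hfinj).2 hb₁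
  have h₃ := scaleRoots_eval₂_mul (p := A₂) (C.comp f) (C (f b₁)⁻¹ * B₁.map f) b₁
  have hCb : C (f b₁) * (C (f b₁)⁻¹ * B₁.map f) = B₁.map f := by
    rw [← mul_assoc, ← C_mul, mul_inv_cancel₀ hfb, C_1, one_mul]
  have hCa : ∀ T : (FractionRing R)[X], C (f a₂) * (C (f a₂)⁻¹ * T) = T := fun T => by
    rw [← mul_assoc, ← C_mul, mul_inv_cancel₀ hfa, C_1, one_mul]
  have h₄ : S.map f - X =
      C (f a₂)⁻¹ * eval₂ (C.comp f) (C (f b₁)⁻¹ * B₁.map f) A₂ := by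
    rw [← h₂, hQ, h₁, add_sub_cancel_left, aeval_def,
      eval₂_map]
    rfl
  rw [RingHom.comp_apply, hCb] at h₃
  rw [map_comp, comp, eval₂_map, h₃]
  simp only [Polynomial.map_mul, Polynomial.map_sub, map_C, map_X, Polynomial.map_pow, C_pow]
  rw [h₄, hCa]

/-- Let `R` be a UFD with fraction field `K`, `a₁, a₂, b₁ ∈ R` nonzero,
`A₁, A₂ ∈ R[X]`, `B₁ ∈ R[Y]` with `A₁(0) = A₂(0) = B₁(0) = 0` and `gcd(B₁, b₁) = 1`.
If `Y + A₁(X)/a₁ + A₂(X + B₁(Y + A₁(X)/a₁)/b₁)/a₂ ∈ K[X,Y]` has all of its coefficients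
in `R`, then `A₂(X) = C(b₁X)` for some `C ∈ R[X]`. -/
theorem stmt_2 {R : Type*} [CommRing R] [IsDomain R] [UniqueFactorizationMonoid R]
    (a₁ a₂ b₁ : R) (ha₁ : a₁ ≠ 0) (ha₂ : a₂ ≠ 0) (hb₁ : b₁ ≠ 0)
    (A₁ A₂ B₁ : Polynomial R)
    (hA₁0 : Polynomial.eval 0 A₁ = 0) (hA₂0 : Polynomial.eval 0 A₂ = 0)
    (hB₁0 : Polynomial.eval 0 B₁ = 0)
    (hgcd : ∀ d : Polynomial R, d ∣ B₁ → d ∣ Polynomial.C b₁ → IsUnit d)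
    (hint : ∀ m : Fin 2 →₀ ℕ,
      (secondCoord a₁ a₂ b₁ A₁ A₂ B₁).coeff m ∈ Set.range (algebraMap R (FractionRing R))) :
    ∃ C : Polynomial R, A₂ = C.comp (Polynomial.C b₁ * Polynomial.X) := by
  have hdvd : Polynomial.C (b₁ ^ A₂.natDegree) ∣ A₂.scaleRoots b₁ := by
    refine C_dvd_of_C_dvd_comp (pow_ne_zero _ hb₁) hB₁0 (fun p hp hpb hpB => hp.not_isUnit ?_)
      (C_pow_dvd_scaleRoots_comp ha₂ hb₁ hA₁0 hint)
    exact Polynomial.isUnit_C.1 (hgcd _ hpB (map_dvd Polynomial.C (hp.dvd_of_dvd_pow hpb)))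
  obtain ⟨C, hC⟩ := hdvd
  refine ⟨C, Polynomial.ext fun n => ?_⟩
  have hn := congrArg (Polynomial.coeff · n) hC
  simp only [Polynomial.coeff_scaleRoots, Polynomial.coeff_C_mul] at hn
  rw [Polynomial.comp_C_mul_X_coeff]
  rcases le_or_gt n A₂.natDegree with h | h
  · refine mul_right_cancel₀ (pow_ne_zero (A₂.natDegree - n) hb₁) ?_
    rw [hn, mul_assoc, ← pow_add, Nat.add_sub_cancel' h, mul_comm]
  · rw [Polynomial.coeff_eq_zero_of_natDegree_lt h, zero_mul, eq_comm, mul_eq_zero] at hn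
    rw [Polynomial.coeff_eq_zero_of_natDegree_lt h,
      hn.resolve_left (pow_ne_zero _ hb₁), zero_mul]

end
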